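/- arXiv:2009.12706 — 7 statements merged into one kernel-verified Lean document; each statement's English description precedes it below -/
import Mathlib

section
/- (Proposition 2.1(b), diagonal derivative.) Let l = (l₁, l₂, l₃) satisfy the strict triangle inequalities. Then for each i ∈ {1, 2, 3} the function w ↦ a_i(w) is differentiable at w = 0 and its partial derivative with respect to w_i at w = 0 equals −sin(a_i(0)) / (sin(a_j(0)) · sin(a_k(0))), where {i, j, k} = {1, 2, 3}; in particular this partial derivative is negative. -/
open Real

/-- The inner angle opposite the side of length `r` in a generalized triangle with
side lengths `p`, `q`, `r` (law of cosines). -/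
noncomputable def triAngle (p q r : ℝ) : ℝ :=
  Real.arccos ((p ^ 2 + q ^ 2 - r ^ 2) / (2 * p * q))

/-- Vertex-scaled side lengths `w*l`: `(w*l)ᵢ = e^{wⱼ+w_k} lᵢ` for `{i,j,k} = {1,2,3}`
(indices taken in `Fin 3`, cyclically). -/
noncomputable def wl (l w : Fin 3 → ℝ) (i : Fin 3) : ℝ :=
  Real.exp (w (i + 1) + w (i + 2)) * l i

/-- Weak triangle inequalities for positive side lengths (a generalized triangle). -/
def IsGenTriF (l : Fin 3 → ℝ) : Prop :=
  (∀ i, 0 < l i) ∧ ∀ i : Fin 3, l i ≤ l (i + 1) + l (i + 2)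

/-- Strict triangle inequalities for positive side lengths (a nondegenerate triangle). -/
def IsTriF (l : Fin 3 → ℝ) : Prop :=
  (∀ i, 0 < l i) ∧ ∀ i : Fin 3, l i < l (i + 1) + l (i + 2)

/-- The inner angle `aᵢ(w)` at the vertex `vᵢ` of the scaled triangle `w*l`,
i.e. the angle opposite the side of length `(w*l)ᵢ`. -/
noncomputable def angF (l : Fin 3 → ℝ) (i : Fin 3) (w : Fin 3 → ℝ) : ℝ :=
  triAngle (wl l w (i + 1)) (wl l w (i + 2)) (wl l w i)

theorem IsTriF.heron_pos {l : Fin 3 → ℝ} (hl : IsTriF l) (i : Fin 3) :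
    0 < (2 * l (i + 1) * l (i + 2)) ^ 2 - (l (i + 1) ^ 2 + l (i + 2) ^ 2 - l i ^ 2) ^ 2 := by
  have h0 := hl.2 i
  have h1 := hl.2 (i + 1)
  have h2 := hl.2 (i + 2)
  rw [show i + 1 + 1 = i + 2 by grind, show i + 1 + 2 = i by grind] at h1
  rw [show i + 2 + 1 = i by grind, show i + 2 + 2 = i + 1 by grind] at h2
  have h := mul_pos (mul_pos (sub_pos.2 h0) (sub_pos.2 h1))
    (mul_pos (sub_pos.2 h2) (add_pos (add_pos (hl.1 i) (hl.1 (i + 1))) (hl.1 (i + 2))))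
  linarith

/-- The law of sines, with the area expressed by Heron's formula. -/
theorem sin_triAngle {p q : ℝ} (hp : 0 < p) (hq : 0 < q) (r : ℝ) :
    Real.sin (triAngle p q r) =
      √((2 * p * q) ^ 2 - (p ^ 2 + q ^ 2 - r ^ 2) ^ 2) / (2 * p * q) := by
  rw [triAngle, Real.sin_arccos]
  have h : 1 - ((p ^ 2 + q ^ 2 - r ^ 2) / (2 * p * q)) ^ 2 =
      ((2 * p * q) ^ 2 - (p ^ 2 + q ^ 2 - r ^ 2) ^ 2) / (2 * p * q) ^ 2 := by
    field_simp
  rw [h, Real.sqrt_div' _ (sq_nonneg _), Real.sqrt_sq (by positivity)]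

theorem wl_zero (l : Fin 3 → ℝ) : wl l 0 = l := by
  ext i
  simp [wl]

theorem wl_add_one_smul_single (l : Fin 3 → ℝ) (i : Fin 3) (t : ℝ) :
    wl l (t • Pi.single i 1) (i + 1) = Real.exp t * l (i + 1) := by
  fin_cases i <;> simp [wl]

theorem wl_add_two_smul_single (l : Fin 3 → ℝ) (i : Fin 3) (t : ℝ) :
    wl l (t • Pi.single i 1) (i + 2) = Real.exp t * l (i + 2) := by
  fin_cases i <;> simp [wl]

theorem wl_smul_single_self (l : Fin 3 → ℝ) (i : Fin 3) (t : ℝ) :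
    wl l (t • Pi.single i 1) i = l i := by
  fin_cases i <;> simp [wl]

theorem differentiable_wl (l : Fin 3 → ℝ) (i : Fin 3) :
    Differentiable ℝ fun w => wl l w i := by
  unfold wl
  fun_prop

/-- The cosine of a nondegenerate angle is not `±1`, so that `arccos` is differentiable there. -/
theorem IsTriF.cos_sq_lt_one {l : Fin 3 → ℝ} (hl : IsTriF l) (i : Fin 3) :
    ((l (i + 1) ^ 2 + l (i + 2) ^ 2 - l i ^ 2) / (2 * l (i + 1) * l (i + 2))) ^ 2 < 1 := by
  have h1 := hl.1 (i + 1)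
  have h2 := hl.1 (i + 2)
  rw [div_pow, div_lt_one (by positivity)]
  linarith [hl.heron_pos i]

theorem IsTriF.differentiableAt_angF {l : Fin 3 → ℝ} (hl : IsTriF l) (i : Fin 3) :
    DifferentiableAt ℝ (angF l i) 0 := by
  have h1 := (hl.1 (i + 1)).ne'
  have h2 := (hl.1 (i + 2)).ne'
  have hc := hl.cos_sq_lt_one i
  have d := fun j => (differentiable_wl l j) 0
  have hd : DifferentiableAt ℝ (fun w => (wl l w (i + 1) ^ 2 + wl l w (i + 2) ^ 2 - wl l w i ^ 2) /
      (2 * wl l w (i + 1) * wl l w (i + 2))) 0 := by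
    have h0 : 2 * wl l 0 (i + 1) * wl l 0 (i + 2) ≠ 0 := by simp [wl_zero, h1, h2]
    fun_prop (disch := exact h0)
  refine DifferentiableAt.comp (g := Real.arccos) 0
    (Real.differentiableAt_arccos.2 ?_) hd
  simp only [wl_zero]
  constructor <;> intro h <;> norm_num [h] at hc

theorem IsTriF.hasLineDerivAt_angF {l : Fin 3 → ℝ} (hl : IsTriF l) (i : Fin 3) :
    HasLineDerivAt ℝ (angF l i)
      (-(l i ^ 2 / (l (i + 1) * l (i + 2) * Real.sin (angF l i 0)))) 0 (Pi.single i 1) := by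
  have h1 := (hl.1 (i + 1)).ne'
  have h2 := (hl.1 (i + 2)).ne'
  have hc := hl.cos_sq_lt_one i
  have hline : (fun t : ℝ => angF l i (0 + t • Pi.single i 1)) =
      fun t => Real.arccos
        ((l (i + 1) ^ 2 + l (i + 2) ^ 2 - l i ^ 2 * Real.exp (-2 * t)) /
          (2 * l (i + 1) * l (i + 2))) := by
    ext t
    rw [zero_add, angF, wl_add_one_smul_single, wl_add_two_smul_single, wl_smul_single_self,
      triAngle, show -2 * t = -t + -t by ring, Real.exp_add, Real.exp_neg]
    congr 1
    field_simp
  have hsin : Real.sin (angF l i 0) =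
      √(1 - ((l (i + 1) ^ 2 + l (i + 2) ^ 2 - l i ^ 2) / (2 * l (i + 1) * l (i + 2))) ^ 2) := by
    rw [angF, triAngle, wl_zero, Real.sin_arccos]
  have hcos : HasDerivAt
      (fun t : ℝ => (l (i + 1) ^ 2 + l (i + 2) ^ 2 - l i ^ 2 * Real.exp (-2 * t)) /
        (2 * l (i + 1) * l (i + 2)))
      (l i ^ 2 / (l (i + 1) * l (i + 2))) 0 := by
    have h := ((((hasDerivAt_id (0 : ℝ)).const_mul (-2)).exp.const_mul (l i ^ 2)).const_sub
      (l (i + 1) ^ 2 + l (i + 2) ^ 2)).div_const (2 * l (i + 1) * l (i + 2))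
    refine h.congr_deriv ?_
    simp only [id_eq, mul_zero, Real.exp_zero]
    field_simp
  rw [HasLineDerivAt, hline, hsin]
  have ha := Real.hasDerivAt_arccos
    (x := (l (i + 1) ^ 2 + l (i + 2) ^ 2 - l i ^ 2) / (2 * l (i + 1) * l (i + 2)))
    (by intro h; norm_num [h] at hc) (by intro h; norm_num [h] at hc)
  refine (HasDerivAt.comp (h₂ := Real.arccos) (0 : ℝ) (by simpa using ha) hcos).congr_deriv ?_
  ring

/-- (Proposition 2.1(b), diagonal derivative.)  For a nondegenerate triangle `l`, the
angle function `w ↦ aᵢ(w)` is differentiable at `w = 0` and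
`∂aᵢ/∂wᵢ(0) = −sin(aᵢ(0))/(sin(aⱼ(0))·sin(a_k(0))) < 0`, where `{i,j,k} = {1,2,3}`. -/
theorem angle_diagonal_derivative
    (l : Fin 3 → ℝ) (hl : IsTriF l) (i : Fin 3) :
    DifferentiableAt ℝ (angF l i) (0 : Fin 3 → ℝ) ∧
    fderiv ℝ (angF l i) (0 : Fin 3 → ℝ) (Pi.single i 1) =
      -Real.sin (angF l i 0) /
        (Real.sin (angF l (i + 1) 0) * Real.sin (angF l (i + 2) 0)) ∧
    fderiv ℝ (angF l i) (0 : Fin 3 → ℝ) (Pi.single i 1) < 0 := by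
  have hd := hl.differentiableAt_angF i
  have ha := hl.1 i
  have hb := hl.1 (i + 1)
  have hc := hl.1 (i + 2)
  have hf : fderiv ℝ (angF l i) (0 : Fin 3 → ℝ) (Pi.single i 1) =
      -(l i ^ 2 / (l (i + 1) * l (i + 2) * Real.sin (angF l i 0))) := by
    rw [← hd.lineDeriv_eq_fderiv, (hl.hasLineDerivAt_angF i).lineDeriv]
  have hH := Real.sqrt_pos.2 (hl.heron_pos i)
  have hA : Real.sin (angF l i 0) =
      √((2 * l (i + 1) * l (i + 2)) ^ 2 - (l (i + 1) ^ 2 + l (i + 2) ^ 2 - l i ^ 2) ^ 2) /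
        (2 * l (i + 1) * l (i + 2)) := by
    rw [angF, wl_zero, sin_triAngle hb hc]
  have hB : Real.sin (angF l (i + 1) 0) =
      √((2 * l (i + 1) * l (i + 2)) ^ 2 - (l (i + 1) ^ 2 + l (i + 2) ^ 2 - l i ^ 2) ^ 2) /
        (2 * l (i + 2) * l i) := by
    rw [angF, wl_zero, show i + 1 + 1 = i + 2 by grind, show i + 1 + 2 = i by grind,
      sin_triAngle hc ha]
    congr 2
    ring
  have hC : Real.sin (angF l (i + 2) 0) =
      √((2 * l (i + 1) * l (i + 2)) ^ 2 - (l (i + 1) ^ 2 + l (i + 2) ^ 2 - l i ^ 2) ^ 2) /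
        (2 * l i * l (i + 1)) := by
    rw [angF, wl_zero, show i + 2 + 1 = i by grind, show i + 2 + 2 = i + 1 by grind,
      sin_triAngle ha hb]
    congr 2
    ring
  refine ⟨hd, ?_, ?_⟩
  · rw [hf, hA, hB, hC]
    field_simp
  · rw [hf, hA, neg_lt_zero]
    positivity
end

section
/- (Proposition 2.1(b), positive semidefiniteness.) Let l = (l₁, l₂, l₃) satisfy the strict triangle inequalities. Then the 3×3 real matrix M whose (r, s)-entry is −(∂a_r/∂w_s)(0) (the negative of the partial derivative at w = 0 of the angle a_r with respect to w_s) is symmetric and positive semidefinite, and its kernel is exactly the linear span of the vector (1, 1, 1). -/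
open Real

/-- Sixteen times the squared area of the triangle with side lengths `a`, `b`, `c` (Heron). -/
def heron (a b c : ℝ) : ℝ :=
  4 * a ^ 2 * b ^ 2 - (a ^ 2 + b ^ 2 - c ^ 2) ^ 2

lemma heron_pos {a b c : ℝ} (ha : 0 < a) (hb : 0 < b) (hc : 0 < c) (h₁ : a < b + c)
    (h₂ : b < c + a) (h₃ : c < a + b) : 0 < heron a b c := by
  have h : heron a b c = (a + b + c) * (b + c - a) * (c + a - b) * (a + b - c) := by
    unfold heron; ring
  rw [h]
  exact mul_pos (mul_pos (mul_pos (by linarith) (by linarith)) (by linarith)) (by linarith)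

lemma heron_rotate (a b c : ℝ) : heron b c a = heron a b c := by
  unfold heron; ring

lemma triAngle_exp {a b c : ℝ} (ha : 0 < a) (hb : 0 < b) (x y z : ℝ) :
    triAngle (exp (z + x) * a) (exp (x + y) * b) (exp (y + z) * c) =
      arccos (a / (2 * b) * exp (z - y) + b / (2 * a) * exp (y - z)
        - c ^ 2 / (2 * a * b) * exp (y + z - 2 * x)) := by
  unfold triAngle
  congr 1
  rw [two_mul x]
  simp only [exp_sub, exp_add]
  field_simp

/-- The derivative of an angle under vertex scaling. -/
lemma hasFDerivAt_triAngle_exp {ι : Type*} [Fintype ι] {a b c : ℝ} (ha : 0 < a) (hb : 0 < b)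
    (hS : 0 < heron a b c) (i j k : ι) :
    HasFDerivAt (fun w : ι → ℝ =>
        triAngle (exp (w k + w i) * a) (exp (w i + w j) * b) (exp (w j + w k) * c))
      ((√(heron a b c))⁻¹ •
        ((-(2 * c ^ 2)) • (ContinuousLinearMap.proj i : (ι → ℝ) →L[ℝ] ℝ)
          + (a ^ 2 + c ^ 2 - b ^ 2) • (ContinuousLinearMap.proj j : (ι → ℝ) →L[ℝ] ℝ)
          + (b ^ 2 + c ^ 2 - a ^ 2) • (ContinuousLinearMap.proj k : (ι → ℝ) →L[ℝ] ℝ))) 0 := by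
  simp_rw [triAngle_exp ha hb]
  have hp (m : ι) : HasFDerivAt (fun w : ι → ℝ => w m)
      (ContinuousLinearMap.proj m : (ι → ℝ) →L[ℝ] ℝ) 0 := hasFDerivAt_apply m 0
  have hg := ((((hp k).sub (hp j)).exp.const_mul (a / (2 * b))).add
    (((hp j).sub (hp k)).exp.const_mul (b / (2 * a)))).sub
    ((((hp j).add (hp k)).sub ((hp i).const_mul 2)).exp.const_mul (c ^ 2 / (2 * a * b)))
  set u : ℝ := (a ^ 2 + b ^ 2 - c ^ 2) / (2 * a * b) with hu
  have hab : 0 < 2 * a * b := by positivity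
  have hsq : 1 - u ^ 2 = heron a b c / (2 * a * b) ^ 2 := by
    rw [hu, heron]; field_simp; ring
  have hlt : 0 < 1 - u ^ 2 := by rw [hsq]; positivity
  have hval : a / (2 * b) * exp ((0 : ι → ℝ) k - (0 : ι → ℝ) j)
      + b / (2 * a) * exp ((0 : ι → ℝ) j - (0 : ι → ℝ) k)
      - c ^ 2 / (2 * a * b) * exp ((0 : ι → ℝ) j + (0 : ι → ℝ) k - 2 * (0 : ι → ℝ) i) = u := by
    simp [hu]; field_simp
  have hsqrt : √(1 - u ^ 2) = √(heron a b c) / (2 * a * b) := by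
    rw [hsq, sqrt_div hS.le, sqrt_sq hab.le]
  have hs : 0 < √(heron a b c) := sqrt_pos.2 hS
  have ha' := hasDerivAt_arccos (x := u) (by nlinarith) (by nlinarith)
  rw [← hval] at ha'
  have := ha'.comp_hasFDerivAt (0 : ι → ℝ) hg
  refine this.congr_fderiv ?_
  rw [hval, hsqrt]
  ext v
  simp
  field_simp
  ring

lemma fin_three_neg_one : -(1 : Fin 3) = 2 := rfl

lemma fin_three_neg_two : -(2 : Fin 3) = 1 := rfl

lemma fderiv_angF {l : Fin 3 → ℝ} (hl : IsTriF l) (i s : Fin 3) :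
    fderiv ℝ (angF l i) 0 (Pi.single s 1) =
      (√(heron (l 0) (l 1) (l 2)))⁻¹ *
        (if s = i then -(2 * l i ^ 2)
          else l i ^ 2 + l s ^ 2 - l (-(i + s)) ^ 2) := by
  obtain ⟨h0, h1⟩ := hl
  have hS : 0 < heron (l 0) (l 1) (l 2) :=
    heron_pos (h0 0) (h0 1) (h0 2) (h1 0) (h1 1) (h1 2)
  have hSi : heron (l (i + 1)) (l (i + 2)) (l i) = heron (l 0) (l 1) (l 2) := by
    fin_cases i
    · exact heron_rotate _ _ _
    · exact (heron_rotate _ _ _).symm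
    · rfl
  have h := hasFDerivAt_triAngle_exp (c := l i) (h0 (i + 1)) (h0 (i + 2)) (hSi ▸ hS)
    i (i + 1) (i + 2)
  have hf : angF l i = fun w : Fin 3 → ℝ =>
      triAngle (exp (w (i + 2) + w i) * l (i + 1)) (exp (w i + w (i + 1)) * l (i + 2))
        (exp (w (i + 1) + w (i + 2)) * l i) := by
    funext w
    fin_cases i <;> rfl
  rw [hf, h.fderiv, hSi]
  fin_cases i <;> fin_cases s <;>
    simp [fin_three_neg_one, fin_three_neg_two] <;> exact Or.inl (by ring)

/-- (Proposition 2.1(b), positive semidefiniteness.)  For a nondegenerate triangle `l`,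
the matrix `M = [−∂a_r/∂w_s(0)]` is symmetric and positive semidefinite, and its kernel
is exactly the span of `(1,1,1)`. -/
theorem angle_derivative_matrix_posSemidef
    (l : Fin 3 → ℝ) (hl : IsTriF l) :
    let M : Matrix (Fin 3) (Fin 3) ℝ :=
      fun r s => -(fderiv ℝ (angF l r) (0 : Fin 3 → ℝ) (Pi.single s 1))
    M.IsSymm ∧ M.PosSemidef ∧
      ∀ v : Fin 3 → ℝ, M.mulVec v = 0 ↔ ∃ c : ℝ, v = fun _ => c := by
  intro M
  have hS : 0 < heron (l 0) (l 1) (l 2) :=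
    heron_pos (hl.1 0) (hl.1 1) (hl.1 2) (hl.2 0) (hl.2 1) (hl.2 2)
  have hs : 0 < (√(heron (l 0) (l 1) (l 2)))⁻¹ := inv_pos.2 (sqrt_pos.2 hS)
  have hM (r s : Fin 3) : M r s = (√(heron (l 0) (l 1) (l 2)))⁻¹ *
      (if s = r then 2 * l r ^ 2 else l (-(r + s)) ^ 2 - l r ^ 2 - l s ^ 2) := by
    change -(fderiv ℝ (angF l r) 0 (Pi.single s 1)) = _
    rw [fderiv_angF hl]
    split_ifs <;> ring
  generalize (√(heron (l 0) (l 1) (l 2)))⁻¹ = t at hs hM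
  have hsymm : M.IsSymm := by
    ext r s
    rw [Matrix.transpose_apply, hM, hM, add_comm s r]
    split_ifs with h₁ h₂ h₂
    · rw [h₁]
    · exact absurd h₁.symm h₂
    · exact absurd h₂.symm h₁
    · ring
  unfold heron at hS
  have hl0 : 0 < l 0 ^ 2 := pow_pos (hl.1 0) 2
  refine ⟨hsymm, .of_dotProduct_mulVec_nonneg ?_ fun v => ?_, fun v => ⟨fun h => ?_, ?_⟩⟩
  · rwa [Matrix.IsHermitian, Matrix.conjTranspose_eq_transpose_of_trivial]
  · have key : star v ⬝ᵥ M.mulVec v = t / (2 * l 0 ^ 2) *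
        ((2 * l 0 ^ 2 * (v 0 - v 2) + (l 2 ^ 2 - l 0 ^ 2 - l 1 ^ 2) * (v 1 - v 2)) ^ 2
          + (4 * l 0 ^ 2 * l 1 ^ 2 - (l 0 ^ 2 + l 1 ^ 2 - l 2 ^ 2) ^ 2) * (v 1 - v 2) ^ 2) := by
      simp [dotProduct, Matrix.mulVec, Fin.sum_univ_three, hM,
        fin_three_neg_two, fin_three_neg_one]
      have := (hl.1 0).ne'
      field_simp
      ring
    rw [key]
    positivity
  · have h0 := congrFun h 0
    have h1 := congrFun h 1
    simp [dotProduct, Matrix.mulVec, Fin.sum_univ_three, hM,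
      fin_three_neg_two, fin_three_neg_one] at h0 h1
    have h0' : 2 * l 0 ^ 2 * (v 0 - v 2) + (l 2 ^ 2 - l 0 ^ 2 - l 1 ^ 2) * (v 1 - v 2) = 0 :=
      mul_left_cancel₀ hs.ne' (by linear_combination h0)
    have h1' : (l 2 ^ 2 - l 0 ^ 2 - l 1 ^ 2) * (v 0 - v 2) + 2 * l 1 ^ 2 * (v 1 - v 2) = 0 :=
      mul_left_cancel₀ hs.ne' (by linear_combination h1)
    have h12 : v 1 - v 2 = 0 := mul_left_cancel₀ hS.ne'
      (by linear_combination 2 * l 0 ^ 2 * h1' - (l 2 ^ 2 - l 0 ^ 2 - l 1 ^ 2) * h0')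
    have h02 : v 0 - v 2 = 0 := mul_left_cancel₀ hl0.ne'
      (by linear_combination h0' / 2 - (l 2 ^ 2 - l 0 ^ 2 - l 1 ^ 2) / 2 * h12)
    refine ⟨v 2, funext fun i => ?_⟩
    fin_cases i
    · exact sub_eq_zero.1 h02
    · exact sub_eq_zero.1 h12
    · rfl
  · rintro ⟨c, rfl⟩
    ext i
    fin_cases i <;>
      simp [dotProduct, Matrix.mulVec, Fin.sum_univ_three, hM,
        fin_three_neg_two, fin_three_neg_one] <;> ring
end

section
/- (Proposition 2.1(c), first part.) Let l = (l₁, l₂, l₃) be positive reals with l₃ = l₁ + l₂ (a degenerate triangle with flat vertex v₃). Then: (i) there exists ε > 0 such that for all t ∈ (0, ε), the scaled lengths (0,0,t)*l = (e^t l₁, e^t l₂, l₃) satisfy the strict triangle inequalities; and (ii) the function t ↦ a₃((0,0,t)) is strictly decreasing on the set S = {t ∈ ℝ : (0,0,t)*l satisfies the weak triangle inequalities}. -/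
open Real

theorem wl_zero_zero (l : Fin 3 → ℝ) (t : ℝ) :
    wl l ![0, 0, t] = ![Real.exp t * l 0, Real.exp t * l 1, l 2] := by
  ext i
  fin_cases i <;> simp [wl, show (2 : Fin 3) + 1 = 0 from rfl, show (1 : Fin 3) + 2 = 0 from rfl,
    show (2 : Fin 3) + 2 = 1 from rfl, show (1 : Fin 3) + 1 = 2 from rfl]

theorem isGenTriF_vec {a b c : ℝ} :
    IsGenTriF ![a, b, c] ↔
      (0 < a ∧ 0 < b ∧ 0 < c) ∧ a ≤ b + c ∧ b ≤ c + a ∧ c ≤ a + b := by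
  simp [IsGenTriF, Fin.forall_fin_succ, show (2 : Fin 3) + 1 = 0 from rfl,
    show (1 : Fin 3) + 2 = 0 from rfl, show (2 : Fin 3) + 2 = 1 from rfl,
    show (1 : Fin 3) + 1 = 2 from rfl]

theorem isTriF_vec {a b c : ℝ} :
    IsTriF ![a, b, c] ↔
      (0 < a ∧ 0 < b ∧ 0 < c) ∧ a < b + c ∧ b < c + a ∧ c < a + b := by
  simp [IsTriF, Fin.forall_fin_succ, show (2 : Fin 3) + 1 = 0 from rfl,
    show (1 : Fin 3) + 2 = 0 from rfl, show (2 : Fin 3) + 2 = 1 from rfl,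
    show (1 : Fin 3) + 1 = 2 from rfl]

theorem angF_two_zero_zero (l : Fin 3 → ℝ) (t : ℝ) :
    angF l 2 ![0, 0, t] = triAngle (Real.exp t * l 0) (Real.exp t * l 1) (l 2) := by
  simp [angF, wl_zero_zero, show (2 : Fin 3) + 1 = 0 from rfl, show (2 : Fin 3) + 2 = 1 from rfl]

/-- The cosine of the angle of a generalized triangle lies in `[-1, 1]`. -/
theorem cos_law_mem_Icc {a b c : ℝ} (h : IsGenTriF ![a, b, c]) :
    (a ^ 2 + b ^ 2 - c ^ 2) / (2 * a * b) ∈ Set.Icc (-1 : ℝ) 1 := by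
  obtain ⟨⟨ha, hb, hc⟩, h₁, h₂, h₃⟩ := isGenTriF_vec.1 h
  have hab : 0 < 2 * a * b := by positivity
  rw [Set.mem_Icc, le_div_iff₀ hab, div_le_one hab]
  constructor <;> nlinarith

/-- Enlarging both adjacent sides by the same factor strictly increases the cosine. -/
theorem cos_law_scale_strictMono {a b c : ℝ} (ha : 0 < a) (hb : 0 < b) (hc : 0 < c) :
    StrictMono fun t : ℝ => ((Real.exp t * a) ^ 2 + (Real.exp t * b) ^ 2 - c ^ 2) /
      (2 * (Real.exp t * a) * (Real.exp t * b)) := by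
  intro s t hst
  have hs := Real.exp_pos s
  have hlt : Real.exp s ^ 2 < Real.exp t ^ 2 := by gcongr
  have key (u : ℝ) : ((Real.exp u * a) ^ 2 + (Real.exp u * b) ^ 2 - c ^ 2) /
      (2 * (Real.exp u * a) * (Real.exp u * b)) =
      (a ^ 2 + b ^ 2) / (2 * a * b) - c ^ 2 / (2 * a * b) / Real.exp u ^ 2 := by
    field_simp
  simp only [key]
  gcongr

/-- (Proposition 2.1(c), first part.)  For a degenerate triangle `l` with flat vertex
`v₃` (`l₃ = l₁ + l₂`, indices `0,1,2` in `Fin 3`): for small `t > 0` the scaled lengths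
`(0,0,t)*l` satisfy the strict triangle inequalities, and the angle `a₃((0,0,t))` at the
flat vertex is strictly decreasing in `t` on the set of `t` for which `(0,0,t)*l`
satisfies the weak triangle inequalities. -/
theorem degenerate_flat_angle_decreasing
    (l : Fin 3 → ℝ) (hpos : ∀ i, 0 < l i) (hdeg : l 2 = l 0 + l 1) :
    (∃ ε > 0, ∀ t ∈ Set.Ioo (0 : ℝ) ε, IsTriF (wl l ![0, 0, t])) ∧
    StrictAntiOn (fun t : ℝ => angF l 2 ![0, 0, t])
      {t : ℝ | IsGenTriF (wl l ![0, 0, t])} := by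
  refine ⟨?_, fun s hs t ht hst => ?_⟩
  · have h0 := hpos 0
    have h1 := hpos 1
    have hcont (a : ℝ) : ContinuousAt (fun t : ℝ => Real.exp t * a) 0 := by fun_prop
    have e₁ : ∀ᶠ t in nhds (0 : ℝ), Real.exp t * (l 0 - l 1) < l 2 :=
      (hcont _).eventually_lt continuousAt_const (by simp; linarith)
    have e₂ : ∀ᶠ t in nhds (0 : ℝ), Real.exp t * (l 1 - l 0) < l 2 :=
      (hcont _).eventually_lt continuousAt_const (by simp; linarith)
    obtain ⟨ε, hε, h⟩ := Metric.eventually_nhds_iff.1 (e₁.and e₂)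
    refine ⟨ε, hε, fun t ht => ?_⟩
    obtain ⟨h₁, h₂⟩ := h (y := t) (by rw [Real.dist_0_eq_abs, abs_of_pos ht.1]; exact ht.2)
    have hexp : 1 < Real.exp t := Real.one_lt_exp_iff.2 ht.1
    rw [wl_zero_zero, isTriF_vec]
    refine ⟨⟨by positivity, by positivity, hpos 2⟩, ?_, ?_, ?_⟩ <;> nlinarith
  · rw [Set.mem_ofPred_eq, wl_zero_zero] at hs ht
    simp only [angF_two_zero_zero, triAngle]
    exact Real.strictAntiOn_arccos (cos_law_mem_Icc hs) (cos_law_mem_Icc ht)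
      (cos_law_scale_strictMono (hpos 0) (hpos 1) (hpos 2) hst)
end

section
/- (Proposition 2.1(c), second part.) Let l = (l₁, l₂, l₃) be positive reals with l₃ = l₁ + l₂ (a degenerate triangle with flat vertex v₃). Then there exists ε > 0 such that both functions t ↦ a₁((0,0,t)) and t ↦ a₂((0,0,t)) are strictly increasing on the interval [0, ε), where (0,0,t)*l = (e^t l₁, e^t l₂, l₃). -/
open Real

lemma triAngle_comm (p q r : ℝ) : triAngle p q r = triAngle q p r := by
  unfold triAngle
  congr 1
  ring

/-- The angle between the sides `s * y` and `x + y` of the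
triangle with sides `s * x`, `s * y`, `x + y`. -/
lemma triAngle_scaled_eq {x y s : ℝ} (hx : 0 < x) (hy : 0 < y) (hs : 0 < s) :
    triAngle (s * y) (x + y) (s * x) =
      Real.arccos ((s ^ 2 * (y - x) + (x + y)) / (2 * s * y)) := by
  unfold triAngle
  have hxy : 0 < x + y := by positivity
  congr 1
  field_simp
  ring

lemma triAngle_scaled_lt {x y s u : ℝ} (hx : 0 < x) (hy : 0 < y) (hs : 1 ≤ s) (hsu : s < u)
    (hux : u ^ 2 * x < x + y) (huy : u ^ 2 * y < x + y) :
    triAngle (s * y) (x + y) (s * x) < triAngle (u * y) (x + y) (u * x) := by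
  have hs0 : 0 < s := by linarith
  have hu0 : 0 < u := by linarith
  have hsu2 : s ^ 2 < u ^ 2 := by nlinarith
  rw [triAngle_scaled_eq hx hy hs0, triAngle_scaled_eq hx hy hu0]
  have key : s * u * (y - x) < x + y := by
    have h₁ : s * u * y ≤ u ^ 2 * y := by gcongr; nlinarith
    have h₂ : 0 < s * u * x := by positivity
    linarith
  have hlt : (u ^ 2 * (y - x) + (x + y)) / (2 * u * y) <
      (s ^ 2 * (y - x) + (x + y)) / (2 * s * y) := by
    rw [div_lt_div_iff₀ (by positivity) (by positivity)]
    have h : 0 < 2 * y * ((u - s) * (x + y - s * u * (y - x))) :=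
      mul_pos (by positivity) (mul_pos (by linarith) (by linarith))
    linarith
  have hle : (s ^ 2 * (y - x) + (x + y)) / (2 * s * y) ≤ 1 := by
    rw [div_le_one (by positivity)]
    have h₁ : s * y ≤ s * u * y := by
      have : s ≤ s * u := by nlinarith
      gcongr
    have h₂ : s * (y - x) ≤ x + y := by
      have : s * y ≤ u ^ 2 * y := by gcongr; nlinarith
      have : 0 < s * x := by positivity
      linarith
    nlinarith [mul_nonneg (sub_nonneg.2 hs) (sub_nonneg.2 h₂)]
  have hge : 0 ≤ (u ^ 2 * (y - x) + (x + y)) / (2 * u * y) := by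
    have : 0 < u ^ 2 * y := by positivity
    exact div_nonneg (by linarith) (by positivity)
  exact Real.strictAntiOn_arccos ⟨by linarith, by linarith⟩ ⟨by linarith, hle⟩ hlt

/-- (Proposition 2.1(c), second part.)  For a degenerate triangle `l` with flat vertex
`v₃` (`l₃ = l₁ + l₂`, indices `0,1,2` in `Fin 3`), there is `ε > 0` such that the angles
`a₁((0,0,t))` and `a₂((0,0,t))` are strictly increasing for `t ∈ [0, ε)`. -/
theorem degenerate_other_angles_increasing
    (l : Fin 3 → ℝ) (hpos : ∀ i, 0 < l i) (hdeg : l 2 = l 0 + l 1) :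
    ∃ ε > 0,
      StrictMonoOn (fun t : ℝ => angF l 0 ![0, 0, t]) (Set.Ico (0 : ℝ) ε) ∧
      StrictMonoOn (fun t : ℝ => angF l 1 ![0, 0, t]) (Set.Ico (0 : ℝ) ε) := by
  have h0 := hpos 0
  have h1 := hpos 1
  set x := l 0
  set y := l 1
  have hm : 0 < max x y := lt_max_of_lt_left h0
  have hlt : max x y < x + y := max_lt (by linarith) (by linarith)
  have hbound : ∀ t < Real.log ((x + y) / max x y) / 2,
      Real.exp t ^ 2 * x < x + y ∧ Real.exp t ^ 2 * y < x + y := by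
    intro t ht
    have h : Real.exp t ^ 2 < (x + y) / max x y := by
      rw [← Real.exp_nat_mul, ← Real.lt_log_iff_exp_lt (by positivity)]
      push_cast
      linarith
    rw [lt_div_iff₀ hm] at h
    exact ⟨(mul_le_mul_of_nonneg_left (le_max_left x y) (by positivity)).trans_lt h,
      (mul_le_mul_of_nonneg_left (le_max_right x y) (by positivity)).trans_lt h⟩
  have hang0 : ∀ t, angF l 0 ![0, 0, t] =
      triAngle (Real.exp t * y) (x + y) (Real.exp t * x) := by
    intro t
    simp [angF, wl, hdeg, x, y]
  have hang1 : ∀ t, angF l 1 ![0, 0, t] =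
      triAngle (Real.exp t * x) (y + x) (Real.exp t * y) := by
    intro t
    rw [triAngle_comm]
    simp [angF, wl, hdeg, x, y, add_comm]
  refine ⟨Real.log ((x + y) / max x y) / 2,
    half_pos (Real.log_pos ((one_lt_div hm).2 hlt)), ?_, ?_⟩
  · intro a ha b hb hab
    simp only [hang0]
    obtain ⟨hbx, hby⟩ := hbound b hb.2
    exact triAngle_scaled_lt h0 h1 (Real.one_le_exp ha.1) (Real.exp_lt_exp.2 hab) hbx hby
  · intro a ha b hb hab
    simp only [hang1]
    obtain ⟨hbx, hby⟩ := hbound b hb.2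
    exact triAngle_scaled_lt h1 h0 (Real.one_le_exp ha.1) (Real.exp_lt_exp.2 hab)
      (by linarith) (by linarith)
end

section
/- (Corollary 2.2.) Let l = (l₁, l₂, l₃) be the side lengths of a generalized triangle and let w : ℝ → ℝ³ be differentiable at t₀ with the property that w(t₀)*l satisfies the strict triangle inequalities. Then for any {i, j, k} = {1, 2, 3}, the function t ↦ a_i(w(t)) is differentiable at t₀ with derivative cot(a_k(w(t₀))) · (w_j′(t₀) − w_i′(t₀)) + cot(a_j(w(t₀))) · (w_k′(t₀) − w_i′(t₀)), where cot(θ) = cos(θ)/sin(θ) and w_m′(t₀) denotes the derivative of the m-th coordinate of w at t₀. -/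
open Real

/-- The Heron product: sixteen times the squared area of the triangle. -/
def heronProd (p q r : ℝ) : ℝ :=
  (p + q + r) * (p + q - r) * (p - q + r) * (-p + q + r)

theorem heronProd_pos {p q r : ℝ} (hp : 0 < p) (hq : 0 < q) (hr : 0 < r)
    (h₁ : p < q + r) (h₂ : q < p + r) (h₃ : r < p + q) : 0 < heronProd p q r := by
  have k₃ : 0 < p + q - r := by linarith
  have k₂ : 0 < p - q + r := by linarith
  have k₁ : 0 < -p + q + r := by linarith
  unfold heronProd
  positivity

theorem one_sub_sq_cosine_quotient {p q : ℝ} (r : ℝ) (hp : 0 < p) (hq : 0 < q) :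
    1 - ((p ^ 2 + q ^ 2 - r ^ 2) / (2 * p * q)) ^ 2 = heronProd p q r / (2 * p * q) ^ 2 := by
  unfold heronProd
  field_simp
  ring

theorem sqrt_one_sub_sq_cosine_quotient {p q : ℝ} (r : ℝ) (hp : 0 < p) (hq : 0 < q) :
    √(1 - ((p ^ 2 + q ^ 2 - r ^ 2) / (2 * p * q)) ^ 2) = √(heronProd p q r) / (2 * p * q) := by
  rw [one_sub_sq_cosine_quotient r hp hq, Real.sqrt_div' _ (by positivity),
    Real.sqrt_sq (by positivity)]

theorem abs_cosine_quotient_lt_one {p q r : ℝ} (hp : 0 < p) (hq : 0 < q)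
    (hD : 0 < heronProd p q r) : |(p ^ 2 + q ^ 2 - r ^ 2) / (2 * p * q)| < 1 := by
  rw [← sq_lt_one_iff_abs_lt_one, ← sub_pos, one_sub_sq_cosine_quotient r hp hq]
  positivity

theorem cos_div_sin_triAngle {p q r : ℝ} (hp : 0 < p) (hq : 0 < q)
    (hD : 0 < heronProd p q r) :
    Real.cos (triAngle p q r) / Real.sin (triAngle p q r) =
      (p ^ 2 + q ^ 2 - r ^ 2) / √(heronProd p q r) := by
  obtain ⟨h₁, h₂⟩ := abs_lt.mp (abs_cosine_quotient_lt_one hp hq hD)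
  have hS : 0 < √(heronProd p q r) := Real.sqrt_pos.mpr hD
  rw [triAngle, Real.cos_arccos h₁.le h₂.le, Real.sin_arccos,
    sqrt_one_sub_sq_cosine_quotient r hp hq]
  field_simp

/-- Derivative of an angle in terms of the logarithmic derivatives `α`, `β`, `γ` of the sides. -/
theorem hasDerivAt_triAngle {p q r : ℝ → ℝ} {α β γ t : ℝ}
    (hp : HasDerivAt p (α * p t) t) (hq : HasDerivAt q (β * q t) t)
    (hr : HasDerivAt r (γ * r t) t) (hp₀ : 0 < p t) (hq₀ : 0 < q t) (hr₀ : 0 < r t)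
    (hD : 0 < heronProd (p t) (q t) (r t)) :
    HasDerivAt (fun s => triAngle (p s) (q s) (r s))
      (Real.cos (triAngle (r t) (p t) (q t)) / Real.sin (triAngle (r t) (p t) (q t)) * (γ - α) +
        Real.cos (triAngle (q t) (r t) (p t)) / Real.sin (triAngle (q t) (r t) (p t)) *
          (γ - β)) t := by
  have hDq : heronProd (r t) (p t) (q t) = heronProd (p t) (q t) (r t) := by
    unfold heronProd; ring
  have hDp : heronProd (q t) (r t) (p t) = heronProd (p t) (q t) (r t) := by
    unfold heronProd; ring
  obtain ⟨h₁, h₂⟩ := abs_lt.mp (abs_cosine_quotient_lt_one hp₀ hq₀ hD)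
  have hx := (((hp.pow 2).add (hq.pow 2)).sub (hr.pow 2)).div ((hp.const_mul 2).mul hq)
    (by simp only [Pi.mul_apply]; positivity)
  have hS : 0 < √(heronProd (p t) (q t) (r t)) := Real.sqrt_pos.mpr hD
  refine ((Real.hasDerivAt_arccos h₁.ne' h₂.ne).comp t hx).congr_deriv ?_
  rw [cos_div_sin_triAngle hr₀ hp₀ (hDq ▸ hD), cos_div_sin_triAngle hq₀ hr₀ (hDp ▸ hD),
    hDq, hDp, sqrt_one_sub_sq_cosine_quotient (r t) hp₀ hq₀]
  simp only [Pi.mul_apply, Pi.add_apply, Pi.sub_apply, Pi.pow_apply]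
  field_simp
  ring

theorem hasDerivAt_wl (l : Fin 3 → ℝ) {w : ℝ → Fin 3 → ℝ} {w' : Fin 3 → ℝ} {t : ℝ}
    (hw : ∀ m : Fin 3, HasDerivAt (fun s => w s m) (w' m) t) (i : Fin 3) :
    HasDerivAt (fun s => wl l (w s) i) ((w' (i + 1) + w' (i + 2)) * wl l (w t) i) t := by
  refine ((((hw (i + 1)).add (hw (i + 2))).exp).mul_const (l i)).congr_deriv ?_
  simp only [wl, Pi.add_apply]
  ring

theorem hasDerivAt_angF {l : Fin 3 → ℝ} {w : ℝ → Fin 3 → ℝ} {w' : Fin 3 → ℝ} {t : ℝ}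
    (hw : ∀ m : Fin 3, HasDerivAt (fun s => w s m) (w' m) t)
    (htri : IsTriF (wl l (w t))) (i : Fin 3) :
    HasDerivAt (fun s => angF l i (w s))
      (Real.cos (angF l (i + 2) (w t)) / Real.sin (angF l (i + 2) (w t)) * (w' (i + 1) - w' i) +
        Real.cos (angF l (i + 1) (w t)) / Real.sin (angF l (i + 1) (w t)) *
          (w' (i + 2) - w' i)) t := by
  obtain ⟨hpos, hlt⟩ := htri
  have e₁₁ : i + 1 + 1 = i + 2 := by grind
  have e₁₂ : i + 1 + 2 = i := by grind
  have e₂₁ : i + 2 + 1 = i := by grind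
  have e₂₂ : i + 2 + 2 = i + 1 := by grind
  have h₀ := hlt i
  have h₁ := hlt (i + 1)
  have h₂ := hlt (i + 2)
  rw [e₁₁, e₁₂] at h₁
  rw [e₂₁, e₂₂] at h₂
  have key := hasDerivAt_triAngle (hasDerivAt_wl l hw (i + 1)) (hasDerivAt_wl l hw (i + 2))
    (hasDerivAt_wl l hw i) (hpos _) (hpos _) (hpos _)
    (heronProd_pos (hpos _) (hpos _) (hpos _) h₁ (by linarith) h₀)
  refine key.congr_deriv ?_
  simp only [angF, e₁₁, e₁₂, e₂₁, e₂₂]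
  ring

/-- (Corollary 2.2.)  If `w : ℝ → ℝ³` is differentiable at `t₀` and `w(t₀)*l` is a
nondegenerate triangle, then `t ↦ aᵢ(w(t))` is differentiable at `t₀` with derivative
`cot(a_k)(wⱼ' − wᵢ') + cot(aⱼ)(w_k' − wᵢ')`, where `{i,j,k} = {1,2,3}` and
`cot θ = cos θ / sin θ`. -/
theorem angle_derivative_along_path
    (l : Fin 3 → ℝ) (hl : IsGenTriF l)
    (w : ℝ → Fin 3 → ℝ) (w' : Fin 3 → ℝ) (t₀ : ℝ)
    (hw : ∀ m : Fin 3, HasDerivAt (fun t => w t m) (w' m) t₀)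
    (htri : IsTriF (wl l (w t₀)))
    (i j k : Fin 3) (hij : i ≠ j) (hik : i ≠ k) (hjk : j ≠ k) :
    HasDerivAt (fun t => angF l i (w t))
      (Real.cos (angF l k (w t₀)) / Real.sin (angF l k (w t₀)) * (w' j - w' i) +
        Real.cos (angF l j (w t₀)) / Real.sin (angF l j (w t₀)) * (w' k - w' i)) t₀ := by
  have hcases : j = i + 1 ∧ k = i + 2 ∨ j = i + 2 ∧ k = i + 1 := by
    revert i j k
    decide
  rcases hcases with ⟨rfl, rfl⟩ | ⟨rfl, rfl⟩
  · exact hasDerivAt_angF hw htri i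
  · exact (hasDerivAt_angF hw htri i).congr_deriv (add_comm _ _)
end

section
/- (Proposition 3.4(a): flatness of spiral metrics from linear conformal factors.) Assume the lattice triangulation T_st determined by u₁, u₂ is Delaunay for the standard Euclidean metric. Let λ, μ > 0 and define the linear conformal factor w(m, n) := m·ln(λ) + n·ln(μ) for (m, n) ∈ ℤ², and the scaled edge lengths ℓ(a, b) := e^{w(a)+w(b)} · |L a − L b| for adjacent a, b ∈ ℤ². Suppose that every triangle of T_st satisfies the weak triangle inequalities in the lengths ℓ, and that ℓ is Delaunay: for every edge {a, b} shared by two triangles with third vertices c and d, the two inner angles opposite that edge (computed from the ℓ-side-lengths by the law-of-cosines formula arccos((p²+q²−r²)/(2pq))) sum to at most π. Then the scaled metric is flat: for every vertex v ∈ ℤ², the sum over the six triangles of T_st containing v of the ℓ-inner-angle at v equals 2π. -/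
open Real

/-- The Euclidean angle `∠(x, z, y)` at `z` between the segments `zx` and `zy`. -/
noncomputable def eAngle (x z y : ℂ) : ℝ :=
  triAngle (dist z x) (dist z y) (dist x y)

/-- The lattice point map `L(m, n) = m·u₁ + n·u₂`. -/
noncomputable def Lpt (u₁ u₂ : ℂ) (a : ℤ × ℤ) : ℂ :=
  (a.1 : ℂ) * u₁ + (a.2 : ℂ) * u₂

/-- The Delaunay condition for the lattice triangulation `T_st` in the standard
Euclidean metric: for each edge shared by two triangles, the two Euclidean angles
opposite the edge sum to at most `π`. -/
def LatDelaunay (P : ℤ × ℤ → ℂ) : Prop :=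
  ∀ v : ℤ × ℤ,
    eAngle (P v) (P (v + (0, 1))) (P (v + (1, 0))) +
      eAngle (P v) (P (v + (1, -1))) (P (v + (1, 0))) ≤ π ∧
    eAngle (P v) (P (v + (1, 0))) (P (v + (0, 1))) +
      eAngle (P v) (P (v + (-1, 1))) (P (v + (0, 1))) ≤ π ∧
    eAngle (P (v + (1, 0))) (P v) (P (v + (0, 1))) +
      eAngle (P (v + (1, 0))) (P (v + (1, 1))) (P (v + (0, 1))) ≤ π

/-- The linear conformal factor `w(m,n) = m·ln λ + n·ln μ`. -/
noncomputable def linW (lam mu : ℝ) (a : ℤ × ℤ) : ℝ :=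
  (a.1 : ℝ) * Real.log lam + (a.2 : ℝ) * Real.log mu

/-- The scaled edge length `ℓ(a,b) = e^{w(a)+w(b)}·|L a − L b|`. -/
noncomputable def sLen (u₁ u₂ : ℂ) (lam mu : ℝ) (a b : ℤ × ℤ) : ℝ :=
  Real.exp (linW lam mu a + linW lam mu b) * dist (Lpt u₁ u₂ a) (Lpt u₁ u₂ b)

/-- The `ℓ`-inner-angle at the vertex `v` in the triangle with vertices `v, a, b`,
computed from the `ℓ`-side-lengths by the law of cosines. -/
noncomputable def sAng (u₁ u₂ : ℂ) (lam mu : ℝ) (v a b : ℤ × ℤ) : ℝ :=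
  triAngle (sLen u₁ u₂ lam mu v a) (sLen u₁ u₂ lam mu v b) (sLen u₁ u₂ lam mu a b)

/-- Weak triangle inequalities for three side lengths. -/
def WeakTri (p q r : ℝ) : Prop := p ≤ q + r ∧ q ≤ p + r ∧ r ≤ p + q

theorem triAngle_mul {k : ℝ} (hk : k ≠ 0) (p q r : ℝ) :
    triAngle (k * p) (k * q) (k * r) = triAngle p q r := by
  unfold triAngle
  congr 1
  rw [← mul_div_mul_left (p ^ 2 + q ^ 2 - r ^ 2) (2 * p * q) (pow_ne_zero 2 hk)]
  congr 1 <;> ring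

/-- The inner angles of a possibly degenerate triangle with positive side lengths sum to `π`. -/
theorem triAngle_sum {p q r : ℝ} (hp : 0 < p) (hq : 0 < q) (hr : 0 < r) (h : WeakTri p q r) :
    triAngle p q r + triAngle p r q + triAngle q r p = π := by
  obtain ⟨h₁, h₂, h₃⟩ := h
  have hD : 0 ≤ (p + q + r) * (q + r - p) * (p + r - q) * (p + q - r) :=
    mul_nonneg (mul_nonneg (mul_nonneg (by positivity) (by linarith)) (by linarith)) (by linarith)
  unfold triAngle
  set D := (p + q + r) * (q + r - p) * (p + r - q) * (p + q - r) with hDdef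
  set x := (p ^ 2 + r ^ 2 - q ^ 2) / (2 * p * r) with hx
  set y := (q ^ 2 + r ^ 2 - p ^ 2) / (2 * q * r) with hy
  have hx2 : 1 - x ^ 2 = D / (2 * p * r) ^ 2 := by
    rw [hx, hDdef]; field_simp; ring
  have hy2 : 1 - y ^ 2 = D / (2 * q * r) ^ 2 := by
    rw [hy, hDdef]; field_simp; ring
  have hx1 : x ^ 2 ≤ 1 := by
    have : 0 ≤ D / (2 * p * r) ^ 2 := by positivity
    linarith
  have hy1 : y ^ 2 ≤ 1 := by
    have : 0 ≤ D / (2 * q * r) ^ 2 := by positivity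
    linarith
  obtain ⟨hxl, hxr⟩ := abs_le.mp ((sq_le_one_iff_abs_le_one x).mp hx1)
  obtain ⟨hyl, hyr⟩ := abs_le.mp ((sq_le_one_iff_abs_le_one y).mp hy1)
  have hxy : -y ≤ x := by
    have : x + y = (p + q) * ((q + r - p) * (p + r - q)) / (2 * p * q * r) := by
      rw [hx, hy]; field_simp; ring
    have : 0 ≤ x + y := by
      rw [this]
      have := mul_nonneg (by linarith : 0 ≤ q + r - p) (by linarith : 0 ≤ p + r - q)
      positivity
    linarith
  have hle : arccos x + arccos y ≤ π := by
    have := arccos_le_arccos hxy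
    rw [arccos_neg] at this
    linarith
  have hcos : cos (arccos x + arccos y) = -((p ^ 2 + q ^ 2 - r ^ 2) / (2 * p * q)) := by
    rw [cos_add, cos_arccos hxl hxr, cos_arccos hyl hyr, sin_arccos, sin_arccos, hx2, hy2,
      sqrt_div hD, sqrt_div hD, sqrt_sq (by positivity), sqrt_sq (by positivity),
      div_mul_div_comm √D, mul_self_sqrt hD, hx, hy, hDdef]
    field_simp
    ring
  have hfin := arccos_cos (add_nonneg (arccos_nonneg x) (arccos_nonneg y)) hle
  rw [hcos, arccos_neg] at hfin
  linarith

theorem sLen_comm (u₁ u₂ : ℂ) (lam mu : ℝ) (a b : ℤ × ℤ) :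
    sLen u₁ u₂ lam mu a b = sLen u₁ u₂ lam mu b a := by
  unfold sLen
  rw [dist_comm, add_comm]

theorem sLen_add_right (u₁ u₂ : ℂ) (lam mu : ℝ) (a b t : ℤ × ℤ) :
    sLen u₁ u₂ lam mu (a + t) (b + t) =
      Real.exp (2 * linW lam mu t) * sLen u₁ u₂ lam mu a b := by
  have hL (c : ℤ × ℤ) : Lpt u₁ u₂ (c + t) = Lpt u₁ u₂ c + Lpt u₁ u₂ t := by
    simp only [Lpt, Prod.fst_add, Prod.snd_add]
    push_cast
    ring
  unfold sLen
  rw [hL, hL, dist_add_right, ← mul_assoc, ← Real.exp_add]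
  congr 2
  simp only [linW, Prod.fst_add, Prod.snd_add]
  push_cast
  ring

theorem sLen_pos {u₁ u₂ : ℂ} (hind : LinearIndependent ℝ ![u₁, u₂]) (lam mu : ℝ)
    {a b : ℤ × ℤ} (hab : a ≠ b) : 0 < sLen u₁ u₂ lam mu a b := by
  refine mul_pos (Real.exp_pos _) (dist_pos.mpr fun h => hab ?_)
  have key := LinearIndependent.pair_iff.mp hind ((a.1 : ℝ) - b.1) ((a.2 : ℝ) - b.2) (by
    simp only [Lpt] at h
    simp only [Complex.real_smul]
    push_cast
    linear_combination h)
  exact Prod.ext (Int.cast_injective (sub_eq_zero.mp key.1))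
    (Int.cast_injective (sub_eq_zero.mp key.2))

/-- Translating a triangle rescales its side lengths by a common factor, so the inner angles do
not change. -/
theorem sAng_add_right (u₁ u₂ : ℂ) (lam mu : ℝ) (v a b t : ℤ × ℤ) :
    sAng u₁ u₂ lam mu (v + t) (a + t) (b + t) = sAng u₁ u₂ lam mu v a b := by
  unfold sAng
  rw [sLen_add_right, sLen_add_right, sLen_add_right, triAngle_mul (Real.exp_pos _).ne']

theorem sAng_sum {u₁ u₂ : ℂ} (hind : LinearIndependent ℝ ![u₁, u₂]) {lam mu : ℝ}
    {a b c : ℤ × ℤ} (hab : a ≠ b) (hac : a ≠ c) (hbc : b ≠ c)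
    (h : WeakTri (sLen u₁ u₂ lam mu a b) (sLen u₁ u₂ lam mu a c) (sLen u₁ u₂ lam mu b c)) :
    sAng u₁ u₂ lam mu a b c + sAng u₁ u₂ lam mu b a c + sAng u₁ u₂ lam mu c a b = π := by
  unfold sAng
  rw [sLen_comm u₁ u₂ lam mu b a, sLen_comm u₁ u₂ lam mu c a, sLen_comm u₁ u₂ lam mu c b]
  exact triAngle_sum (sLen_pos hind lam mu hab) (sLen_pos hind lam mu hac)
    (sLen_pos hind lam mu hbc) h

/-- (Proposition 3.4(a): flatness of spiral metrics from linear conformal factors.)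
If the lattice triangulation determined by `u₁, u₂` is Delaunay, `λ, μ > 0`, every
triangle of `T_st` satisfies the weak triangle inequalities in the scaled lengths `ℓ`,
and `ℓ` is Delaunay, then the scaled metric is flat: at every vertex `v` the six
`ℓ`-inner-angles of the six triangles containing `v` sum to `2π`. -/
theorem spiral_metric_flat
    (u₁ u₂ : ℂ) (hind : LinearIndependent ℝ ![u₁, u₂])
    (hstd : LatDelaunay (Lpt u₁ u₂))
    (lam mu : ℝ) (hlam : 0 < lam) (hmu : 0 < mu)
    (htriDown : ∀ v : ℤ × ℤ,
      WeakTri (sLen u₁ u₂ lam mu v (v + (1, 0))) (sLen u₁ u₂ lam mu v (v + (0, 1)))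
        (sLen u₁ u₂ lam mu (v + (1, 0)) (v + (0, 1))))
    (htriUp : ∀ v : ℤ × ℤ,
      WeakTri (sLen u₁ u₂ lam mu (v + (1, 0)) (v + (0, 1)))
        (sLen u₁ u₂ lam mu (v + (1, 0)) (v + (1, 1)))
        (sLen u₁ u₂ lam mu (v + (0, 1)) (v + (1, 1))))
    (hDel : ∀ v : ℤ × ℤ,
      sAng u₁ u₂ lam mu (v + (0, 1)) v (v + (1, 0)) +
        sAng u₁ u₂ lam mu (v + (1, -1)) v (v + (1, 0)) ≤ π ∧
      sAng u₁ u₂ lam mu (v + (1, 0)) v (v + (0, 1)) +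
        sAng u₁ u₂ lam mu (v + (-1, 1)) v (v + (0, 1)) ≤ π ∧
      sAng u₁ u₂ lam mu v (v + (1, 0)) (v + (0, 1)) +
        sAng u₁ u₂ lam mu (v + (1, 1)) (v + (1, 0)) (v + (0, 1)) ≤ π) :
    ∀ v : ℤ × ℤ,
      sAng u₁ u₂ lam mu v (v + (1, 0)) (v + (0, 1)) +
        sAng u₁ u₂ lam mu v (v - (1, 0)) (v + (-1, 1)) +
        sAng u₁ u₂ lam mu v (v - (0, 1)) (v + (1, -1)) +
        sAng u₁ u₂ lam mu v (v + (-1, 1)) (v + (0, 1)) +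
        sAng u₁ u₂ lam mu v (v + (1, -1)) (v + (1, 0)) +
        sAng u₁ u₂ lam mu v (v - (0, 1)) (v - (1, 0)) = 2 * π := by
  intro v
  have hne {a b : ℤ × ℤ} (h : a ≠ b) : v + a ≠ v + b := fun e => h (add_left_cancel e)
  have hne₀ {b : ℤ × ℤ} (h : 0 ≠ b) : v ≠ v + b := by simpa using hne h
  have down := sAng_sum hind (hne₀ (by decide)) (hne₀ (by decide)) (hne (by decide)) (htriDown v)
  have up := sAng_sum hind (hne (by decide)) (hne (by decide)) (hne (by decide)) (htriUp v)
  have t₂ := sAng_add_right u₁ u₂ lam mu v (v - (1, 0)) (v + (-1, 1)) (1, 0)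
  have t₃ := sAng_add_right u₁ u₂ lam mu v (v - (0, 1)) (v + (1, -1)) (0, 1)
  have t₄ := sAng_add_right u₁ u₂ lam mu v (v + (-1, 1)) (v + (0, 1)) (1, 0)
  have t₅ := sAng_add_right u₁ u₂ lam mu v (v + (1, -1)) (v + (1, 0)) (0, 1)
  have t₆ := sAng_add_right u₁ u₂ lam mu v (v - (0, 1)) (v - (1, 0)) (1, 1)
  have e₁ : v - (0, 1) + (1, 1) = v + (1, 0) := by ext <;> simp
  have e₂ : v - (1, 0) + (1, 1) = v + (0, 1) := by ext <;> simp
  rw [e₁, e₂] at t₆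
  simp only [sub_add_cancel, add_assoc, Prod.mk_add_mk] at t₂ t₃ t₄ t₅
  norm_num at t₂ t₃ t₄ t₅
  linarith
end

section
/- (Lemma 5.6 / electric-network gradient bound.) Let n ≥ 1, and consider the n-th subdivision graph with vertex set V, corner A = (0,0) and opposite side V₀ as defined. Let τ : V → V be the involution τ(i, j) = (j, i). Let η be a conductance with η(p, q) ≥ 0 for all adjacent p, q and η(τ(p), τ(q)) = η(p, q). Suppose f : V → ℝ satisfies (Δf)_p = 0 for every p ∉ {A} ∪ V₀ and f(p) = 0 for every p ∈ V₀. Then for every pair of adjacent vertices p, q ∈ V, |η(p, q) · (f(p) − f(q))| ≤ (1/2) · |(Δf)_A|. -/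
open Real
open scoped Classical

/-- The vertex set of the `n`-th standard subdivision of an equilateral triangle:
`{(i,j) : 0 ≤ i, 0 ≤ j, i + j ≤ n}` (coordinates taken in `ℤ`). -/
def inV (n : ℕ) (p : ℤ × ℤ) : Prop :=
  0 ≤ p.1 ∧ 0 ≤ p.2 ∧ p.1 + p.2 ≤ (n : ℤ)

/-- The six potential neighbours of a vertex: differences `±(1,0), ±(0,1), ±(1,−1)`. -/
def nbrs (p : ℤ × ℤ) : Finset (ℤ × ℤ) :=
  {p + (1, 0), p + (-1, 0), p + (0, 1), p + (0, -1), p + (1, -1), p + (-1, 1)}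

/-- The Laplacian associated to a conductance `η`:
`(Δf)_p = Σ_{q ∼ p} η(p,q)·(f(p) − f(q))`, the sum being over the neighbours of `p`
inside the vertex set. -/
noncomputable def lap (n : ℕ) (η : ℤ × ℤ → ℤ × ℤ → ℝ) (f : ℤ × ℤ → ℝ) (p : ℤ × ℤ) : ℝ :=
  ∑ q ∈ (nbrs p).filter (fun q => inV n q), η p q * (f p - f q)

/-- The Laplacian of a finite weighted graph with vertex set `V` and weights `c`. -/
def weightedLap {α : Type*} (V : Finset α) (c : α → α → ℝ) (f : α → ℝ) (p : α) : ℝ :=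
  ∑ q ∈ V, c p q * (f p - f q)

/-- The total current out of `S ⊆ V` only involves the edges from `S` to its complement. -/
lemma sum_weightedLap_eq_cut {α : Type*} {V S : Finset α} (hS : S ⊆ V) {c : α → α → ℝ}
    (hc : ∀ p q, c p q = c q p) (f : α → ℝ) :
    ∑ p ∈ S, weightedLap V c f p = ∑ p ∈ S, ∑ q ∈ V \ S, c p q * (f p - f q) := by
  have hinner : ∑ p ∈ S, ∑ q ∈ S, c p q * (f p - f q) = 0 := by
    have h : ∑ p ∈ S, ∑ q ∈ S, c p q * (f p - f q)
        = -∑ p ∈ S, ∑ q ∈ S, c p q * (f p - f q) := by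
      conv_lhs => rw [Finset.sum_comm]
      simp only [← Finset.sum_neg_distrib]
      refine Finset.sum_congr rfl fun p _ => Finset.sum_congr rfl fun q _ => ?_
      rw [hc q p]
      ring
    linarith
  simp only [weightedLap, ← Finset.sum_sdiff hS, Finset.sum_add_distrib, hinner, add_zero]

/-- Discrete Green identity for the Dirichlet energy. -/
lemma two_mul_sum_mul_weightedLap {α : Type*} (V : Finset α) {c : α → α → ℝ}
    (hc : ∀ p q, c p q = c q p) (f : α → ℝ) :
    2 * ∑ p ∈ V, f p * weightedLap V c f p = ∑ p ∈ V, ∑ q ∈ V, c p q * (f p - f q) ^ 2 := by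
  have h1 : ∑ p ∈ V, f p * weightedLap V c f p
      = ∑ p ∈ V, ∑ q ∈ V, f p * (c p q * (f p - f q)) := by
    simp only [weightedLap, Finset.mul_sum]
  have h2 : ∑ p ∈ V, f p * weightedLap V c f p
      = ∑ p ∈ V, ∑ q ∈ V, f q * (c q p * (f q - f p)) := by
    rw [h1, Finset.sum_comm]
  rw [two_mul]
  nth_rewrite 1 [h1]
  rw [h2]
  simp only [← Finset.sum_add_distrib]
  refine Finset.sum_congr rfl fun p _ => Finset.sum_congr rfl fun q _ => ?_
  rw [hc q p]
  ring

/-- A function with vanishing Dirichlet energy density carries no current. -/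
lemma current_eq_zero_of_mul_weightedLap_eq_zero {α : Type*} {V : Finset α} {c : α → α → ℝ}
    (hc : ∀ p q, c p q = c q p) (hc0 : ∀ p q, 0 ≤ c p q) {g : α → ℝ}
    (hg : ∀ p ∈ V, g p * weightedLap V c g p = 0) {p q : α} (hp : p ∈ V) (hq : q ∈ V) :
    c p q * (g p - g q) = 0 := by
  have h := two_mul_sum_mul_weightedLap V hc g
  rw [Finset.sum_eq_zero hg, mul_zero] at h
  have hnn : ∀ p q, 0 ≤ c p q * (g p - g q) ^ 2 := fun p q => mul_nonneg (hc0 p q) (sq_nonneg _)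
  have h1 := (Finset.sum_eq_zero_iff_of_nonneg fun p _ =>
    Finset.sum_nonneg fun q _ => hnn p q).1 h.symm p hp
  have h2 := (Finset.sum_eq_zero_iff_of_nonneg fun q _ => hnn p q).1 h1 q hq
  rcases mul_eq_zero.1 h2 with h3 | h3
  · rw [h3, zero_mul]
  · rw [pow_eq_zero_iff two_ne_zero |>.1 h3, mul_zero]

lemma weightedLap_comp_symm {α : Type*} {V : Finset α} {c : α → α → ℝ} {τ : α → α}
    (hττ : ∀ p, τ (τ p) = p) (hτV : ∀ p ∈ V, τ p ∈ V) (hτc : ∀ p q, c (τ p) (τ q) = c p q)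
    (f : α → ℝ) (p : α) :
    weightedLap V c (fun r => f (τ r)) p = weightedLap V c f (τ p) := by
  refine Finset.sum_bij' (fun q _ => τ q) (fun q _ => τ q) hτV hτV
    (fun q _ => hττ q) (fun q _ => hττ q) fun q _ => ?_
  rw [hτc]

/-- Superlevel-set bound: a descending edge starting at a positive value, together with its
mirror image, carries at most the current produced at the source `a`. -/
lemma two_mul_current_le_of_pos {α : Type*} {V : Finset α} {c : α → α → ℝ}
    (hc : ∀ p q, c p q = c q p) (hc0 : ∀ p q, 0 ≤ c p q) {τ : α → α}
    (hτV : ∀ p ∈ V, τ p ∈ V) (hτc : ∀ p q, c (τ p) (τ q) = c p q) {a : α} {f : α → ℝ}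
    (hfτ : ∀ p, f (τ p) = f p) (hf : ∀ p ∈ V, p ≠ a → f p ≠ 0 → weightedLap V c f p = 0)
    {p q : α} (hp : p ∈ V) (hq : q ∈ V) (hpos : 0 < f p) (hlt : f q < f p)
    (hne : ¬(τ p = p ∧ τ q = q)) :
    2 * (c p q * (f p - f q)) ≤ |weightedLap V c f a| := by
  classical
  set S := V.filter fun r => f p ≤ f r with hSdef
  have hcut := sum_weightedLap_eq_cut (Finset.filter_subset (fun r => f p ≤ f r) V) hc f
  have hle : ∑ r ∈ S, weightedLap V c f r ≤ |weightedLap V c f a| := by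
    by_cases ha : a ∈ S
    · rw [Finset.sum_eq_single_of_mem a ha]
      · exact le_abs_self _
      · intro r hr hra
        rw [hSdef, Finset.mem_filter] at hr
        exact hf r hr.1 hra (by linarith [hr.2])
    · rw [Finset.sum_eq_zero]
      · exact abs_nonneg _
      · intro r hr
        have hra : r ≠ a := fun h => ha (h ▸ hr)
        rw [hSdef, Finset.mem_filter] at hr
        exact hf r hr.1 hra (by linarith [hr.2])
  rw [← hSdef, ← Finset.sum_product'] at hcut
  have hpair : ∑ x ∈ ({(p, q), (τ p, τ q)} : Finset (α × α)), c x.1 x.2 * (f x.1 - f x.2)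
      = 2 * (c p q * (f p - f q)) := by
    rw [Finset.sum_pair]
    · simp only [hτc, hfτ]
      ring
    · intro h
      rw [Prod.mk.injEq] at h
      exact hne ⟨h.1.symm, h.2.symm⟩
  rw [← hpair]
  refine le_trans ?_ (hcut ▸ hle)
  refine Finset.sum_le_sum_of_subset_of_nonneg ?_ ?_
  · intro x hx
    rw [Finset.mem_insert, Finset.mem_singleton] at hx
    rcases hx with rfl | rfl
    · simp [hSdef, hp, hq, hlt]
    · simp [hSdef, hτV p hp, hτV q hq, hfτ, hlt]
  · intro x hx _
    simp only [hSdef, Finset.mem_product, Finset.mem_sdiff, Finset.mem_filter, not_and,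
      not_le] at hx
    exact mul_nonneg (hc0 _ _) (by linarith [hx.1.2, hx.2.2 hx.2.1])

lemma weightedLap_neg {α : Type*} (V : Finset α) (c : α → α → ℝ) (f : α → ℝ) (p : α) :
    weightedLap V c (fun r => -f r) p = -weightedLap V c f p := by
  rw [weightedLap, weightedLap, ← Finset.sum_neg_distrib]
  exact Finset.sum_congr rfl fun q _ => by ring

lemma two_mul_current_le {α : Type*} {V : Finset α} {c : α → α → ℝ}
    (hc : ∀ p q, c p q = c q p) (hc0 : ∀ p q, 0 ≤ c p q) {τ : α → α}
    (hτV : ∀ p ∈ V, τ p ∈ V) (hτc : ∀ p q, c (τ p) (τ q) = c p q) {a : α} {f : α → ℝ}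
    (hfτ : ∀ p, f (τ p) = f p) (hf : ∀ p ∈ V, p ≠ a → f p ≠ 0 → weightedLap V c f p = 0)
    {p q : α} (hp : p ∈ V) (hq : q ∈ V) (hlt : f q < f p) (hne : ¬(τ p = p ∧ τ q = q)) :
    2 * (c p q * (f p - f q)) ≤ |weightedLap V c f a| := by
  rcases lt_or_ge 0 (f p) with hpos | hneg
  · exact two_mul_current_le_of_pos hc hc0 hτV hτc hfτ hf hp hq hpos hlt hne
  · have h := two_mul_current_le_of_pos (f := fun r => -f r) (a := a) hc hc0 hτV hτc
      (fun r => by rw [hfτ])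
      (fun r hr hra hr0 => by
        rw [weightedLap_neg, hf r hr hra (fun h => hr0 (by rw [h, neg_zero])), neg_zero])
      hq hp (by linarith) (by linarith) (fun h => hne ⟨h.2, h.1⟩)
    rw [weightedLap_neg, abs_neg, hc q p] at h
    linarith

/-- In a network with a reflection `τ` fixing the source `a`, an edge which is not fixed
pointwise carries at most half of the current produced at the source. -/
lemma abs_current_le_half {α : Type*} {V : Finset α} {c : α → α → ℝ}
    (hc : ∀ p q, c p q = c q p) (hc0 : ∀ p q, 0 ≤ c p q) {τ : α → α}
    (hττ : ∀ p, τ (τ p) = p) (hτV : ∀ p ∈ V, τ p ∈ V) (hτc : ∀ p q, c (τ p) (τ q) = c p q)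
    {a : α} (haV : a ∈ V) (ha : τ a = a) {B : Set α} (hτB : ∀ p ∈ B, τ p ∈ B) {f : α → ℝ}
    (hharm : ∀ p ∈ V, p ≠ a → p ∉ B → weightedLap V c f p = 0)
    (hB : ∀ p ∈ V, p ∈ B → f p = 0) {p q : α} (hp : p ∈ V) (hq : q ∈ V)
    (hne : ¬(τ p = p ∧ τ q = q)) :
    |c p q * (f p - f q)| ≤ 1 / 2 * |weightedLap V c f a| := by
  set g : α → ℝ := fun r => f r - f (τ r) with hg
  set h : α → ℝ := fun r => (f r + f (τ r)) / 2 with hh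
  have hgcur : ∀ {p q}, p ∈ V → q ∈ V → c p q * (g p - g q) = 0 := by
    refine current_eq_zero_of_mul_weightedLap_eq_zero hc hc0 fun r hr => ?_
    by_cases hra : r = a
    · simp [hg, hra, ha]
    by_cases hrB : r ∈ B
    · simp [hg, hB r hr hrB, hB _ (hτV r hr) (hτB r hrB)]
    have hsub : weightedLap V c g r
        = weightedLap V c f r - weightedLap V c (fun s => f (τ s)) r := by
      simp only [weightedLap, hg, ← Finset.sum_sub_distrib]
      exact Finset.sum_congr rfl fun s _ => by ring
    rw [hsub, weightedLap_comp_symm hττ hτV hτc, hharm r hr hra hrB,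
      hharm _ (hτV r hr) (fun e => hra (by rw [← hττ r, e, ha]))
        (fun e => hrB (hττ r ▸ hτB _ e))]
    ring
  have hcur : ∀ {p q}, p ∈ V → q ∈ V → c p q * (h p - h q) = c p q * (f p - f q) := by
    intro p q hp hq
    have := hgcur hp hq
    simp only [hg, hh] at this ⊢
    linarith
  have hlap : ∀ {r}, r ∈ V → weightedLap V c h r = weightedLap V c f r := fun hr =>
    Finset.sum_congr rfl fun s hs => hcur hr hs
  have hhτ : ∀ r, h (τ r) = h r := fun r => by simp only [hh, hττ, add_comm]
  have hhharm : ∀ r ∈ V, r ≠ a → h r ≠ 0 → weightedLap V c h r = 0 := by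
    intro r hr hra hr0
    rw [hlap hr]
    refine hharm r hr hra fun hrB => hr0 ?_
    simp [hh, hB r hr hrB, hB _ (hτV r hr) (hτB r hrB)]
  have hale : |weightedLap V c h a| = |weightedLap V c f a| := by
    rw [hlap haV]
  rw [← hcur hp hq, ← hale]
  rcases lt_trichotomy (h p) (h q) with hlt | heq | hlt
  · have := two_mul_current_le hc hc0 hτV hτc hhτ hhharm hq hp hlt (fun e => hne ⟨e.2, e.1⟩)
    rw [hc q p] at this
    rw [abs_of_nonpos (mul_nonpos_of_nonneg_of_nonpos (hc0 _ _) (by linarith))]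
    linarith
  · rw [heq, sub_self, mul_zero, abs_zero]
    positivity
  · have := two_mul_current_le hc hc0 hτV hτc hhτ hhharm hp hq hlt hne
    rw [abs_of_nonneg (mul_nonneg (hc0 _ _) (by linarith))]
    linarith

lemma mem_nbrs_iff {p q : ℤ × ℤ} : q ∈ nbrs p ↔
    (q.1 = p.1 + 1 ∧ q.2 = p.2) ∨ (q.1 = p.1 - 1 ∧ q.2 = p.2) ∨
    (q.1 = p.1 ∧ q.2 = p.2 + 1) ∨ (q.1 = p.1 ∧ q.2 = p.2 - 1) ∨
    (q.1 = p.1 + 1 ∧ q.2 = p.2 - 1) ∨ (q.1 = p.1 - 1 ∧ q.2 = p.2 + 1) := by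
  simp [nbrs, Prod.ext_iff, sub_eq_add_neg]

lemma mem_nbrs_comm {p q : ℤ × ℤ} : q ∈ nbrs p ↔ p ∈ nbrs q := by
  rw [mem_nbrs_iff, mem_nbrs_iff]
  omega

lemma mem_nbrs_swap {p q : ℤ × ℤ} : (q.2, q.1) ∈ nbrs (p.2, p.1) ↔ q ∈ nbrs p := by
  rw [mem_nbrs_iff, mem_nbrs_iff]
  omega

/-- The vertices of the `n`-th subdivision as a finite set. -/
noncomputable def triangleVertices (n : ℕ) : Finset (ℤ × ℤ) :=
  (Finset.Icc (0 : ℤ) n ×ˢ Finset.Icc (0 : ℤ) n).filter (inV n)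

lemma mem_triangleVertices {n : ℕ} {p : ℤ × ℤ} : p ∈ triangleVertices n ↔ inV n p := by
  simp only [triangleVertices, Finset.mem_filter, Finset.mem_product, Finset.mem_Icc, inV]
  omega

lemma lap_eq_weightedLap (n : ℕ) (η : ℤ × ℤ → ℤ × ℤ → ℝ) (f : ℤ × ℤ → ℝ) (p : ℤ × ℤ) :
    lap n η f p =
      weightedLap (triangleVertices n) (fun p q => if q ∈ nbrs p then η p q else 0) f p := by
  simp only [lap, weightedLap, ite_mul, zero_mul]
  rw [← Finset.sum_filter]
  refine Finset.sum_congr ?_ fun _ _ => rfl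
  ext q
  simp only [Finset.mem_filter, mem_triangleVertices, and_comm]

/-- (Lemma 5.6 / electric-network gradient bound.)  Let `τ(i,j) = (j,i)` be the
reflection of the subdivided triangle, `η` a nonnegative `τ`-invariant symmetric
conductance, and `f` a function vanishing on the side `V₀ = {i + j = n}` opposite the
corner `A = (0,0)` and discrete-harmonic away from `{A} ∪ V₀`.  Then the gradient of
`f` along any edge is at most `|(Δf)_A|/2` in absolute value. -/
theorem network_gradient_bound
    (n : ℕ) (hn : 1 ≤ n) (η : ℤ × ℤ → ℤ × ℤ → ℝ)
    (hsymm : ∀ p q : ℤ × ℤ, η p q = η q p)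
    (hnonneg : ∀ p q : ℤ × ℤ, q ∈ nbrs p → 0 ≤ η p q)
    (hτ : ∀ p q : ℤ × ℤ, η (p.2, p.1) (q.2, q.1) = η p q)
    (f : ℤ × ℤ → ℝ)
    (hharm : ∀ p : ℤ × ℤ, inV n p → p ≠ (0, 0) → p.1 + p.2 ≠ (n : ℤ) →
      lap n η f p = 0)
    (hbdry : ∀ p : ℤ × ℤ, inV n p → p.1 + p.2 = (n : ℤ) → f p = 0) :
    ∀ p q : ℤ × ℤ, inV n p → inV n q → q ∈ nbrs p →
      |η p q * (f p - f q)| ≤ (1 / 2) * |lap n η f (0, 0)| := by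
  intro p q hp hq hpq
  have key := abs_current_le_half (V := triangleVertices n)
    (c := fun p q => if q ∈ nbrs p then η p q else 0)
    (τ := fun p => (p.2, p.1)) (a := (0, 0)) (B := {p | p.1 + p.2 = (n : ℤ)}) (f := f)
    (fun p q => by simp only [mem_nbrs_comm (p := p), hsymm p q])
    (fun p q => by
      split_ifs with h
      exacts [hnonneg p q h, le_rfl])
    (fun _ => rfl)
    (fun p hp => by
      simp only [mem_triangleVertices, inV] at hp ⊢
      omega)
    (fun p q => by simp only [mem_nbrs_swap, hτ])
    (mem_triangleVertices.2 (by simp [inV]))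
    rfl
    (fun p hp => by
      simp only [Set.mem_ofPred_eq] at hp ⊢
      omega)
    (fun p hp hp0 hpB => by
      rw [← lap_eq_weightedLap]
      exact hharm p (mem_triangleVertices.1 hp) hp0 hpB)
    (fun p hp hpB => hbdry p (mem_triangleVertices.1 hp) hpB)
    (mem_triangleVertices.2 hp) (mem_triangleVertices.2 hq)
    (fun h => by
      simp only [Prod.ext_iff] at h
      rw [mem_nbrs_iff] at hpq
      omega)
  rw [← lap_eq_weightedLap] at key
  simpa only [if_pos hpq] using key
end
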